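/- The equation 2^r · 3^s − 1 = y^n has no solution in positive integers r, s, y, n with y > 1 and n > 1. -/

import Mathlib

/-- A divisor of `2 ^ r * 3 ^ s` that is coprime to `6` is a unit. -/
lemma isUnit_of_dvd_two_pow_mul_three_pow {a : ℤ} {r s : ℕ} (ha : IsCoprime a 6)
    (h : a ∣ 2 ^ r * 3 ^ s) : IsUnit a := by
  have h2 : IsCoprime a 2 := ha.of_isCoprime_of_dvd_right (by norm_num)
  have h3 : IsCoprime a 3 := ha.of_isCoprime_of_dvd_right (by norm_num)
  exact (h2.pow_right.mul_right h3.pow_right).isUnit_of_dvd' dvd_rfl h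

/-- The geometric sum of `x` over `n` terms is congruent to `n` modulo any divisor of `x - 1`. -/
lemma geom_sum_modEq_of_modEq_one {m x : ℤ} (h : x ≡ 1 [ZMOD m]) (n : ℕ) :
    ∑ i ∈ Finset.range n, x ^ i ≡ n [ZMOD m] := by
  induction n with
  | zero => simp
  | succ k ih =>
    rw [Finset.sum_range_succ]
    push_cast
    exact ih.add (by simpa using h.pow k)

/-- If `x ≡ 1` modulo `6` and `n` is coprime to `6`, then `x ^ n - 1` dividing
`2 ^ r * 3 ^ s` forces `x ^ n - 1 = ± (x - 1)`. -/
lemma pow_sub_one_eq_or_eq_neg {x : ℤ} {n r s : ℕ} (hx : x ≡ 1 [ZMOD 6])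
    (hn : IsCoprime (n : ℤ) 6) (h : x ^ n - 1 ∣ 2 ^ r * 3 ^ s) :
    x ^ n - 1 = x - 1 ∨ x ^ n - 1 = -(x - 1) := by
  set Q := ∑ i ∈ Finset.range n, x ^ i
  have hQ : Q * (x - 1) = x ^ n - 1 := geom_sum_mul x n
  obtain ⟨c, hc⟩ := (geom_sum_modEq_of_modEq_one hx n).dvd
  have hcop : IsCoprime Q 6 := by
    have : Q = n + 6 * (-c) := by linarith
    rw [this]
    exact hn.add_mul_left_left _
  have hunit : IsUnit Q := isUnit_of_dvd_two_pow_mul_three_pow hcop ((Dvd.intro _ hQ).trans h)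
  rcases Int.isUnit_iff.mp hunit with h1 | h1
  · left; rw [← hQ, h1, one_mul]
  · right; rw [← hQ, h1, neg_one_mul]

/-- `z ^ 3 + 1` is not a product of powers of `2` and `3` when `z > 1` and `z ≡ -1` modulo `6`. -/
lemma not_pow_three_add_one_eq {z : ℤ} {r s : ℕ} (hz : 1 < z) (hz6 : z % 6 = 5) :
    2 ^ r * 3 ^ s ≠ z ^ 3 + 1 := by
  intro h
  obtain ⟨m, rfl⟩ : ∃ m, z = 6 * m + 5 := ⟨z / 6, by omega⟩
  -- `z ^ 2 - z + 1 = 3 * P` with `P` coprime to `6`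
  set P := 12 * m ^ 2 + 18 * m + 7 with hP
  have hcop : IsCoprime P 6 := ⟨1, -(2 * m ^ 2 + 3 * m + 1), by rw [hP]; ring⟩
  have hdvd : P ∣ 2 ^ r * 3 ^ s := ⟨3 * (6 * m + 6), by rw [h, hP]; ring⟩
  have hunit : IsUnit P := isUnit_of_dvd_two_pow_mul_three_pow hcop hdvd
  have hm : 0 ≤ m := by omega
  rcases Int.isUnit_iff.mp hunit with h1 | h1 <;> nlinarith

/-- Odd powers do not change residues modulo `6`. -/
lemma pow_modEq_six_of_odd (y : ℕ) {n : ℕ} (hn : Odd n) : y ^ n ≡ y [MOD 6] := by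
  obtain ⟨k, rfl⟩ := hn
  induction k with
  | zero => simp [Nat.ModEq]
  | succ k ih =>
    have hcube : y * y ^ 2 ≡ y [MOD 6] := by
      have := Nat.mod_lt y (show 0 < 6 by norm_num)
      simp only [Nat.ModEq, Nat.mul_mod y, Nat.pow_mod y]
      interval_cases y % 6 <;> rfl
    rw [show 2 * (k + 1) + 1 = 2 * k + 1 + 2 by ring, pow_add]
    exact (ih.mul_right _).trans hcube

/-- The equation `2^r · 3^s - 1 = y^n` has no solution in positive integers
`r, s, y, n` with `y > 1` and `n > 1`. -/
theorem stmt_5 :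
    ¬ ∃ r s y n : ℕ, 0 < r ∧ 0 < s ∧ 1 < y ∧ 1 < n ∧
      2 ^ r * 3 ^ s = y ^ n + 1 := by
  rintro ⟨r, s, y, n, hr, hs, hy, hn, h⟩
  have h6 : (y ^ n + 1) % 6 = 0 := by
    rw [← h]
    exact Nat.mod_eq_zero_of_dvd
      (mul_dvd_mul (dvd_pow_self 2 hr.ne') (dvd_pow_self 3 hs.ne'))
  have hpow : y ^ n % 6 = 5 := by omega
  have hodd : Odd n := by
    rw [← Nat.not_even_iff_odd]
    rintro ⟨k, rfl⟩
    rw [pow_add, Nat.mul_mod] at hpow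
    have := Nat.mod_lt (y ^ k) (show 0 < 6 by norm_num)
    interval_cases y ^ k % 6 <;> omega
  have hbase : y % 6 = 5 := Eq.trans (pow_modEq_six_of_odd y hodd).symm hpow
  have hZ : (2 : ℤ) ^ r * 3 ^ s = (y : ℤ) ^ n + 1 := mod_cast h
  by_cases h3 : 3 ∣ n
  · obtain ⟨m, rfl⟩ := h3
    have hm : Odd m := Nat.Odd.of_mul_right hodd
    have hmod : y ^ m % 6 = 5 := Eq.trans (pow_modEq_six_of_odd y hm) hbase
    have hlt : 1 < y ^ m := Nat.one_lt_pow hm.pos.ne' hy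
    refine not_pow_three_add_one_eq (z := (y : ℤ) ^ m) (r := r) (s := s) (mod_cast hlt)
      (mod_cast hmod) ?_
    rw [hZ, mul_comm, pow_mul]
  · have hcop : IsCoprime (n : ℤ) 6 := by
      rw [show (6 : ℤ) = (6 : ℕ) by rfl, Nat.isCoprime_iff_coprime]
      exact Nat.Coprime.mul_right (m := 2) (n := 3) (Nat.coprime_two_right.mpr hodd)
        ((Nat.Prime.coprime_iff_not_dvd Nat.prime_three).mpr h3).symm
    have hx : (-y : ℤ) ≡ 1 [ZMOD 6] := by
      unfold Int.ModEq
      omega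
    have hlt : (y : ℤ) < (y : ℤ) ^ n := mod_cast lt_self_pow₀ hy hn
    have hneg : (-y : ℤ) ^ n - 1 = -((y : ℤ) ^ n + 1) := by
      rw [hodd.neg_pow]
      ring
    have hdvd : (-y : ℤ) ^ n - 1 ∣ 2 ^ r * 3 ^ s := by
      rw [hneg, hZ, neg_dvd]
    rcases pow_sub_one_eq_or_eq_neg hx hcop hdvd with h1 | h1 <;> rw [hneg] at h1 <;> linarith
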